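/- For any composite positive integers m and n, the group G_{m,n} = (ℤ/m ∗ ℤ/n) × (ℤ × ℤ) admits a non-degenerate skew structure; furthermore, G_{m,n} has a subgroup of finite index which does not admit any non-degenerate skew structure. -/

import Mathlib

/-!
Low-degree group cohomology of a (discrete) group `G` with coefficients in the
trivial representation `ℝ`, realized by explicit inhomogeneous cochains:
`C¹ = (G → ℝ)`, `C² = (G → G → ℝ)`, `C³ = (G → G → G → ℝ)`.
Since the coefficients are trivial, the differential `C⁰ → C¹` vanishes, so
`H¹(G;ℝ) = ker d¹` and `H²(G;ℝ) = ker d² / range d¹`.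
We also define the cup product `H¹ × H¹ → H²` and the notion of a
non-degenerate skew structure on a group (Definition 2.1 of the paper).
-/

noncomputable section

namespace PaperGC

variable (G : Type*) [Group G]

/-- The inhomogeneous differential `C¹(G;ℝ) → C²(G;ℝ)` for trivial coefficients. -/
def d1 : (G → ℝ) →ₗ[ℝ] (G → G → ℝ) where
  toFun f := fun a b => f b - f (a * b) + f a
  map_add' f g := by funext a b; simp only [Pi.add_apply]; ring
  map_smul' r f := by
    funext a b
    simp only [Pi.smul_apply, smul_eq_mul, RingHom.id_apply]
    ring

/-- The inhomogeneous differential `C²(G;ℝ) → C³(G;ℝ)` for trivial coefficients. -/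
def d2 : (G → G → ℝ) →ₗ[ℝ] (G → G → G → ℝ) where
  toFun F := fun a b c => F b c - F (a * b) c + F a (b * c) - F a b
  map_add' F₁ F₂ := by funext a b c; simp only [Pi.add_apply]; ring
  map_smul' r F := by
    funext a b c
    simp only [Pi.smul_apply, smul_eq_mul, RingHom.id_apply]
    ring

/-- `H¹(G;ℝ)`: for trivial coefficients this is the space of 1-cocycles,
i.e. additive characters `G → ℝ`. -/
abbrev H1 : Submodule ℝ (G → ℝ) := LinearMap.ker (d1 G)

/-- The 2-cocycles. -/
abbrev Z2 : Submodule ℝ (G → G → ℝ) := LinearMap.ker (d2 G)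

/-- The 2-coboundaries, viewed inside the 2-cocycles. -/
abbrev B2 : Submodule ℝ (Z2 G) := (LinearMap.range (d1 G)).comap (Z2 G).subtype

/-- `H²(G;ℝ) = Z²/B²`. -/
abbrev H2 : Type _ := (Z2 G) ⧸ (B2 G)

variable {G}

lemma cocycle_add (f : H1 G) (a b : G) :
    (f : G → ℝ) (a * b) = (f : G → ℝ) a + (f : G → ℝ) b := by
  have h := LinearMap.mem_ker.mp f.2
  have h' := congrFun (congrFun h a) b
  simp only [d1, LinearMap.coe_mk, AddHom.coe_mk, Pi.zero_apply] at h'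
  linarith [h']

/-- The cochain-level cup product of two 1-cochains. -/
def cochainCup (f g : G → ℝ) : G → G → ℝ := fun a b => f a * g b

lemma cochainCup_mem_Z2 (f g : H1 G) : cochainCup (f : G → ℝ) g ∈ Z2 G := by
  rw [LinearMap.mem_ker]
  funext a b c
  simp only [d2, LinearMap.coe_mk, AddHom.coe_mk, cochainCup, Pi.zero_apply,
    cocycle_add f, cocycle_add g]
  ring

/-- The cup product `H¹(G;ℝ) × H¹(G;ℝ) → H²(G;ℝ)`, induced by
`(f ∪ g)(a,b) = f(a)·g(b)` on cocycles. -/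
def cup (f g : H1 G) : H2 G :=
  (B2 G).mkQ ⟨cochainCup (f : G → ℝ) g, cochainCup_mem_Z2 f g⟩

variable (G)

/-- A *non-degenerate skew structure* on a discrete group `G` (Definition 2.1):
a non-degenerate alternating bilinear form on `H¹(G;ℝ)` which factors through
the cup product via a linear functional `σ : H²(G;ℝ) → ℝ`. -/
def HasNondegSkewStructure : Prop :=
  ∃ B : H1 G →ₗ[ℝ] H1 G →ₗ[ℝ] ℝ,
    (∀ a : H1 G, B a a = 0) ∧
    (∀ x : H1 G, (∀ y : H1 G, B y x = 0) → x = 0) ∧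
    ∃ σ : H2 G →ₗ[ℝ] ℝ, ∀ a b : H1 G, B a b = σ (cup a b)

/-- A group is finitely presentable if it is isomorphic to the quotient of a
finitely generated free group by the normal closure of finitely many relations. -/
def FinitelyPresentable : Prop :=
  ∃ (n : ℕ) (rels : Finset (FreeGroup (Fin n))),
    Nonempty (PresentedGroup (↑rels : Set (FreeGroup (Fin n))) ≃* G)

/-- `G` has a nontrivial finite quotient, i.e. there is a proper normal subgroup
of finite index. -/
def HasNontrivialFiniteQuotient : Prop :=
  ∃ K : Subgroup G, K.Normal ∧ K.FiniteIndex ∧ K ≠ ⊤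

end PaperGC

/-- A positive integer is composite if it is greater than `1` and not prime. -/
def Nat.IsComposite (m : ℕ) : Prop := 1 < m ∧ ¬ m.Prime

namespace GmnProof

open Monoid

section wreath

variable {A B P N : Type*} [Group A] [Group B] [Group P] [Group N]

/-- The section `(a,b) ↦ a b` of `A ∗ B → A × B`. -/
def sec (q : A × B) : Coprod A B := Coprod.inl q.1 * Coprod.inr q.2

/-- The section `(a,b) ↦ b a` of `A ∗ B → A × B`. -/
def sec' (q : A × B) : Coprod A B := Coprod.inr q.2 * Coprod.inl q.1

/-- The homomorphism to the wreath product determined by `T`. -/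
def phi (T : A × B → P) : Coprod A B →* RegularWreathProduct P (A × B) :=
  Coprod.lift (RegularWreathProduct.inl.comp (MonoidHom.inl A B))
    ((MulAut.conj (⟨T, 1⟩ : RegularWreathProduct P (A × B))).toMonoidHom.comp
      (RegularWreathProduct.inl.comp (MonoidHom.inr A B)))

lemma phi_inl (T : A × B → P) (a : A) : phi T (Coprod.inl a) = ⟨1, (a, 1)⟩ := by
  simp [phi]; rfl

lemma phi_inr (T : A × B → P) (b : B) :
    phi T (Coprod.inr b) = ⟨fun q => T q * (T ((1, b⁻¹) * q))⁻¹, (1, b)⟩ := by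
  simp only [phi, Coprod.lift_apply_inr]
  ext q <;> simp

lemma phi_right (T : A × B → P) (x : Coprod A B) : (phi T x).right = Coprod.toProd x := by
  have : RegularWreathProduct.rightHom.comp (phi T) = Coprod.toProd := by
    ext x
    all_goals simp [phi_inl, phi_inr]
  exact DFunLike.congr_fun this x

lemma toProd_sec (q : A × B) : Coprod.toProd (sec q) = q := by simp [sec]
lemma toProd_sec' (q : A × B) : Coprod.toProd (sec' q) = q := by simp [sec']

lemma lift_key (T : A × B → P) (p : P →* N) (ψ : Coprod A B → N)
    (hψ : ∀ x y, Coprod.toProd x = 1 → Coprod.toProd y = 1 → ψ (x * y) = ψ x * ψ y)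
    (hT : ∀ q, p (T q) = ψ ((sec q)⁻¹ * sec' q)) (x : Coprod A B) :
    ∀ q, p ((phi T x).left q) = ψ ((sec q)⁻¹ * x * sec ((Coprod.toProd x)⁻¹ * q)) := by
  have h1 : ψ 1 = 1 := by
    have := hψ 1 1 (map_one _) (map_one _)
    simpa using this
  have hinv : ∀ x, Coprod.toProd x = 1 → ψ x⁻¹ = (ψ x)⁻¹ := by
    intro x hx
    have := hψ x⁻¹ x (by simp [hx]) hx
    rw [inv_mul_cancel, h1] at this
    exact eq_inv_of_mul_eq_one_left this.symm
  induction x using Coprod.induction_on with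
  | inl a =>
    intro q
    rw [phi_inl]
    simp [sec, mul_assoc, h1]
  | inr b =>
    intro q
    rw [phi_inr]
    simp only [map_mul, map_inv, hT]
    have hm : ∀ q : A × B, Coprod.toProd ((sec q)⁻¹ * sec' q) = 1 := by
      intro q
      rw [map_mul, map_inv, toProd_sec, toProd_sec', inv_mul_cancel]
    rw [← hinv _ (hm _), ← hψ _ _ (hm _) (by rw [map_inv, hm, inv_one])]
    congr 1
    simp [sec, sec', mul_assoc]
  | mul x y hx hy =>
    intro q
    simp only [map_mul, RegularWreathProduct.mul_left, Pi.mul_apply, hx, hy, phi_right]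
    rw [← hψ _ _ (by simp [toProd_sec]) (by simp [toProd_sec])]
    congr 1
    simp [mul_assoc]

lemma phi_mul_one (T : A × B → P) (x y : Coprod A B) (hx : Coprod.toProd x = 1) :
    (phi T (x * y)).left 1 = (phi T x).left 1 * (phi T y).left 1 := by
  simp [phi_right, hx]

lemma phi_comm (T : A × B → P) (a : A) (b : B) :
    (phi T ((Coprod.inr b)⁻¹ * (Coprod.inl a)⁻¹ * Coprod.inr b * Coprod.inl a)).left 1
      = T 1 * (T (1, b))⁻¹ * T (a, b) * (T (a, 1))⁻¹ := by
  simp [phi_inl, phi_inr, mul_assoc, Prod.one_eq_mk]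

end wreath

/-- The real Heisenberg group. -/
@[ext]
structure Heis where
  x : ℝ
  y : ℝ
  z : ℝ

namespace Heis

instance : Mul Heis := ⟨fun a b => ⟨a.x + b.x, a.y + b.y, a.z + b.z + a.x * b.y⟩⟩
instance : One Heis := ⟨⟨0, 0, 0⟩⟩
instance : Inv Heis := ⟨fun a => ⟨-a.x, -a.y, -a.z + a.x * a.y⟩⟩

@[simp] lemma mul_x (a b : Heis) : (a * b).x = a.x + b.x := rfl
@[simp] lemma mul_y (a b : Heis) : (a * b).y = a.y + b.y := rfl
@[simp] lemma mul_z (a b : Heis) : (a * b).z = a.z + b.z + a.x * b.y := rfl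
@[simp] lemma one_x : (1 : Heis).x = 0 := rfl
@[simp] lemma one_y : (1 : Heis).y = 0 := rfl
@[simp] lemma one_z : (1 : Heis).z = 0 := rfl
@[simp] lemma inv_x (a : Heis) : (a⁻¹).x = -a.x := rfl
@[simp] lemma inv_y (a : Heis) : (a⁻¹).y = -a.y := rfl
@[simp] lemma inv_z (a : Heis) : (a⁻¹).z = -a.z + a.x * a.y := rfl

instance : Group Heis :=
  Group.ofLeftAxioms
    (by intro a b c; ext <;> simp <;> ring)
    (by intro a; ext <;> simp)
    (by intro a; ext <;> simp)

/-- The projection of the Heisenberg group to its abelianization. -/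
def proj : Heis →* Multiplicative (ℝ × ℝ) where
  toFun a := Multiplicative.ofAdd (a.x, a.y)
  map_one' := rfl
  map_mul' _ _ := rfl

end Heis

section main

variable {A B : Type*} [Group A] [Group B]

/-- On the kernel of `A ∗ B → A × B` cup products of characters are coboundaries. -/
lemma cup_trivial (f g : Coprod A B → ℝ)
    (hf : ∀ x y, Coprod.toProd x = 1 → Coprod.toProd y = 1 → f (x * y) = f x + f y)
    (hg : ∀ x y, Coprod.toProd x = 1 → Coprod.toProd y = 1 → g (x * y) = g x + g y) :
    ∃ z : Coprod A B → ℝ, ∀ x y, Coprod.toProd x = 1 → Coprod.toProd y = 1 →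
      z (x * y) = z x + z y + f x * g y := by
  let T : A × B → Heis := fun q => ⟨f ((sec q)⁻¹ * sec' q), g ((sec q)⁻¹ * sec' q), 0⟩
  have key := lift_key T Heis.proj (fun x => Multiplicative.ofAdd (f x, g x))
    (by intro x y hx hy; simp only [hf x y hx hy, hg x y hx hy]; rfl) (fun q => rfl)
  have key' : ∀ x, Coprod.toProd x = 1 → ((phi T x).left 1).x = f x ∧
      ((phi T x).left 1).y = g x := by
    intro x hx
    have h := key x 1
    have hs : sec (1 : A × B) = 1 := by simp [sec]
    rw [hx, inv_one, one_mul, hs, inv_one, one_mul, mul_one] at h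
    have h' : (((phi T x).left 1).x, ((phi T x).left 1).y) = (f x, g x) := h
    exact ⟨congrArg Prod.fst h', congrArg Prod.snd h'⟩
  refine ⟨fun x => ((phi T x).left 1).z, fun x y hx hy => ?_⟩
  simp only
  rw [phi_mul_one T x y hx, Heis.mul_z, (key' x hx).1, (key' y hy).2]

open PaperGC

lemma mem_H1 {G : Type*} [Group G] (f : G → ℝ) (h : ∀ a b, f (a * b) = f a + f b) :
    f ∈ H1 G := by
  rw [LinearMap.mem_ker]
  funext a b
  simp [d1, h]

lemma H1_one {G : Type*} [Group G] (f : H1 G) : (f : G → ℝ) 1 = 0 := by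
  have := cocycle_add f 1 1
  simpa using this

lemma H1_pow {G : Type*} [Group G] (f : H1 G) (a : G) (k : ℕ) :
    (f : G → ℝ) (a ^ k) = k * (f : G → ℝ) a := by
  induction k with
  | zero => simp [H1_one]
  | succ k ih => rw [pow_succ, cocycle_add, ih]; push_cast; ring

lemma H1_inv {G : Type*} [Group G] (f : H1 G) (a : G) :
    (f : G → ℝ) (a⁻¹) = - (f : G → ℝ) a := by
  have := cocycle_add f a⁻¹ a
  rw [inv_mul_cancel, H1_one] at this
  linarith

lemma H1_zpow {G : Type*} [Group G] (f : H1 G) (a : G) (k : ℤ) :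
    (f : G → ℝ) (a ^ k) = k * (f : G → ℝ) a := by
  cases k with
  | ofNat k => simpa using H1_pow f a k
  | negSucc k => rw [zpow_negSucc, H1_inv, H1_pow]; push_cast; ring

lemma H1_torsion {G : Type*} [Group G] (f : H1 G) (a : G) (k : ℕ) (hk : k ≠ 0)
    (h : a ^ k = 1) : (f : G → ℝ) a = 0 := by
  have := H1_pow f a k
  rw [h, H1_one] at this
  have hk' : (k : ℝ) ≠ 0 := by exact_mod_cast hk
  simpa [hk'] using this.symm

abbrev Z : Type := Multiplicative (ℤ × ℤ)

def eu : Z := Multiplicative.ofAdd (1, 0)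
def ev : Z := Multiplicative.ofAdd (0, 1)

lemma Z_eq (z : Z) : z = eu ^ (z.toAdd.1) * ev ^ (z.toAdd.2) := by
  apply Multiplicative.toAdd.injective
  ext <;> simp [eu, ev]

/-- The functional on `H²` obtained by antisymmetrized evaluation on a commuting pair. -/
def sig {G : Type*} [Group G] (u v : G) (h : u * v = v * u) : H2 G →ₗ[ℝ] ℝ :=
  (B2 G).liftQ
    { toFun := fun F => (F : G → G → ℝ) u v - (F : G → G → ℝ) v u
      map_add' := by intro F F'; simp; ring
      map_smul' := by intro r F; simp; ring }
    (by
      rintro ⟨F, hF⟩ ⟨f, hf⟩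
      simp only [Submodule.coe_subtype] at hf
      subst hf
      rw [LinearMap.mem_ker]
      simp only [d1, LinearMap.coe_mk, AddHom.coe_mk, h]
      ring)

lemma sig_cup {G : Type*} [Group G] (u v : G) (h : u * v = v * u) (a b : H1 G) :
    sig u v h (cup a b) = (a : G → ℝ) u * (b : G → ℝ) v - (a : G → ℝ) v * (b : G → ℝ) u := rfl

def Bform {G : Type*} [Group G] (u v : G) : H1 G →ₗ[ℝ] H1 G →ₗ[ℝ] ℝ :=
  LinearMap.mk₂ ℝ
    (fun a b => (a : G → ℝ) u * (b : G → ℝ) v - (a : G → ℝ) v * (b : G → ℝ) u)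
    (by intros; simp; ring) (by intros; simp; ring) (by intros; simp; ring)
    (by intros; simp; ring)

lemma part1 (k l : ℕ) (hk : k ≠ 0) (hl : l ≠ 0) (hA : ∀ a : A, a ^ k = 1)
    (hB : ∀ b : B, b ^ l = 1) : HasNondegSkewStructure (Coprod A B × Z) := by
  have huv : ((1, eu) : Coprod A B × Z) * (1, ev) = (1, ev) * (1, eu) := by
    ext1
    · simp
    · exact mul_comm _ _
  refine ⟨Bform (1, eu) (1, ev), fun a => ?_, fun x hx => ?_, sig _ _ huv, fun a b => ?_⟩
  · simp [Bform]; ring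
  · let p1 : H1 (Coprod A B × Z) := ⟨fun g => ((g.2.toAdd.1 : ℤ) : ℝ), mem_H1 _ (by simp)⟩
    let p2 : H1 (Coprod A B × Z) := ⟨fun g => ((g.2.toAdd.2 : ℤ) : ℝ), mem_H1 _ (by simp)⟩
    have h1 : x.1 (1, ev) = 0 := by
      have := hx p1
      simpa [Bform, p1, eu, ev] using this
    have h2 : x.1 (1, eu) = 0 := by
      have := hx p2
      simpa [Bform, p2, eu, ev] using this
    have h3 : ∀ c : Coprod A B, x.1 (c, 1) = 0 := by
      intro c
      induction c using Coprod.induction_on with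
      | inl a => exact H1_torsion x _ k hk (by ext1 <;> simp [← map_pow, hA])
      | inr a => exact H1_torsion x _ l hl (by ext1 <;> simp [← map_pow, hB])
      | mul c d hc hd =>
        have := cocycle_add x (c, 1) (d, 1)
        simpa [hc, hd] using this
    ext ⟨c, z⟩
    have e : ((c, z) : Coprod A B × Z) = (c, 1) * ((1, eu) ^ (z.toAdd.1) * (1, ev) ^ (z.toAdd.2)) := by
      ext1
      · simp
      · simpa using Z_eq z
    rw [e, cocycle_add, cocycle_add, H1_zpow, H1_zpow, h1, h2, h3]
    simp
  · rw [sig_cup]; rfl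

/-- The finite-index subgroup. -/
abbrev KK (A B : Type*) [Group A] [Group B] : Subgroup (Coprod A B × Z) :=
  (Coprod.toProd.comp (MonoidHom.fst (Coprod A B) Z)).ker

lemma memKK (g : Coprod A B × Z) : g ∈ KK A B ↔ Coprod.toProd g.1 = 1 := Iff.rfl

lemma part2 (a : A) (b : Fin 3 → B) (ha : a ≠ 1) (hb : ∀ i, b i ≠ 1)
    (hinj : Function.Injective b) : ¬ HasNondegSkewStructure (KK A B) := by
  classical
  rintro ⟨F, -, hnd, σ, hσ⟩
  -- products of classes pulled back from the first factor vanish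
  have hiso : ∀ x y : H1 (KK A B),
      (∀ g h : KK A B, g.1.1 = h.1.1 → x.1 g = x.1 h) →
      (∀ g h : KK A B, g.1.1 = h.1.1 → y.1 g = y.1 h) → F x y = 0 := by
    intro x y hx hy
    let ext (x : H1 (KK A B)) : Coprod A B → ℝ := fun c =>
      if h : Coprod.toProd c = 1 then x.1 ⟨(c, 1), h⟩ else 0
    have hext : ∀ (x : H1 (KK A B)) (c d : Coprod A B), Coprod.toProd c = 1 →
        Coprod.toProd d = 1 → ext x (c * d) = ext x c + ext x d := by
      intro x c d hc hd
      have hcd : Coprod.toProd (c * d) = 1 := by rw [map_mul, hc, hd, one_mul]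
      simp only [ext, dif_pos hc, dif_pos hd, dif_pos hcd]
      rw [← cocycle_add]
      congr 1
    obtain ⟨z, hz⟩ := cup_trivial (ext x) (ext y) (hext x) (hext y)
    have hcup : cup x y = 0 := by
      unfold cup
      rw [Submodule.mkQ_apply, Submodule.Quotient.mk_eq_zero]
      refine ⟨fun g => - z g.1.1, ?_⟩
      funext g h
      have e := hz g.1.1 h.1.1 g.2 h.2
      have ex : ext x g.1.1 = x.1 g := by
        have hg : Coprod.toProd g.1.1 = 1 := g.2
        simp only [ext, dif_pos hg]
        exact hx _ _ rfl
      have ey : ext y h.1.1 = y.1 h := by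
        have hg : Coprod.toProd h.1.1 = 1 := h.2
        simp only [ext, dif_pos hg]
        exact hy _ _ rfl
      rw [ex, ey] at e
      simp only [d1, LinearMap.coe_mk, AddHom.coe_mk, Submodule.coe_subtype, cochainCup,
        Subgroup.coe_mul, Prod.fst_mul, e]
      ring
    rw [hσ, hcup, map_zero]
  -- three independent characters
  let T (i : Fin 3) : A × B → Multiplicative ℝ := fun q =>
    Multiplicative.ofAdd (if q = (a, b i) then 1 else 0)
  let χ (i : Fin 3) : H1 (KK A B) :=
    ⟨fun g => ((phi (T i) g.1.1).left 1).toAdd, mem_H1 _ (by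
      intro g h
      exact congrArg Multiplicative.toAdd (phi_mul_one (T i) g.1.1 h.1.1 g.2))⟩
  let c (j : Fin 3) : KK A B :=
    ⟨((Coprod.inr (b j))⁻¹ * (Coprod.inl a)⁻¹ * Coprod.inr (b j) * Coprod.inl a, 1), by
      rw [memKK]; simp⟩
  have hχ : ∀ i j, (χ i).1 (c j) = if j = i then 1 else 0 := by
    intro i j
    simp only [χ, c]
    rw [phi_comm]
    have e1 : T i 1 = 1 := by
      have : (1 : A × B) ≠ (a, b i) := fun h => ha (congrArg Prod.fst h).symm
      simp [T, this]
    have e2 : T i (1, b j) = 1 := by simp [T, Ne.symm ha]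
    have e3 : T i (a, 1) = 1 := by simp [T, Ne.symm (hb i)]
    rw [e1, e2, e3]
    simp [T, hinj.eq_iff]
  let Θ : (Fin 3 → ℝ) →ₗ[ℝ] H1 (KK A B) := Fintype.linearCombination ℝ χ
  have hΘ : ∀ t g, (Θ t).1 g = ∑ i, t i * (χ i).1 g := by
    intro t g
    simp [Θ, Fintype.linearCombination_apply]
  let p1 : H1 (KK A B) := ⟨fun g => ((g.1.2.toAdd.1 : ℤ) : ℝ), mem_H1 _ (by simp)⟩
  let p2 : H1 (KK A B) := ⟨fun g => ((g.1.2.toAdd.2 : ℤ) : ℝ), mem_H1 _ (by simp)⟩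
  let L : (Fin 3 → ℝ) →ₗ[ℝ] (ℝ × ℝ) := ((F p1).prod (F p2)).comp Θ
  have hL : LinearMap.ker L ≠ ⊥ := LinearMap.ker_ne_bot_of_finrank_lt (by simp)
  obtain ⟨t, htL, ht0⟩ := Submodule.exists_mem_ne_zero_of_ne_bot hL
  have htL' : (F p1 (Θ t), F p2 (Θ t)) = 0 := htL
  have ht1 : F p1 (Θ t) = 0 := congrArg Prod.fst htL'
  have ht2 : F p2 (Θ t) = 0 := congrArg Prod.snd htL'
  have hzero : Θ t = 0 := by
    apply hnd
    intro y
    let u : KK A B := ⟨(1, eu), by rw [memKK]; simp⟩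
    let v : KK A B := ⟨(1, ev), by rw [memKK]; simp⟩
    let y0 : H1 (KK A B) := y - y.1 u • p1 - y.1 v • p2
    have hy : y = y0 + y.1 u • p1 + y.1 v • p2 := by
      simp only [y0]; abel
    have hy0 : ∀ g : KK A B, y0.1 g = y.1 ⟨(g.1.1, 1), g.2⟩ := by
      intro g
      have e : g = ⟨(g.1.1, 1), g.2⟩ * (u ^ (g.1.2.toAdd.1) * v ^ (g.1.2.toAdd.2)) := by
        apply Subtype.ext
        ext1
        · simp [u, v]
        · simpa [u, v] using Z_eq g.1.2
      have e2 := congrArg y.1 e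
      rw [cocycle_add, cocycle_add, H1_zpow, H1_zpow] at e2
      simp only [y0, p1, p2, Submodule.coe_sub, Submodule.coe_smul, Pi.sub_apply, Pi.smul_apply,
        smul_eq_mul]
      rw [e2]; ring
    have h0 : F y0 (Θ t) = 0 := by
      apply hiso
      · intro g h hgh
        rw [hy0, hy0]
        exact congrArg y.1 (Subtype.ext (by simp [hgh]))
      · intro g h hgh
        rw [hΘ, hΘ]
        simp only [χ, hgh]
    rw [hy]
    simp [h0, ht1, ht2]
  apply ht0
  funext j
  have := hΘ t (c j)
  rw [hzero] at this
  simpa [hχ] using this.symm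

end main

end GmnProof

/-- **Lemma 3.3.** For composite positive integers `m, n`, the group
`G_{m,n} = (ℤ/m ∗ ℤ/n) × (ℤ × ℤ)` admits a non-degenerate skew structure;
furthermore `G_{m,n}` has a finite-index subgroup which does not admit any
non-degenerate skew structure. -/
theorem Gmn_skew_and_finiteIndex_subgroup_no_skew
    (m n : ℕ) (hm : Nat.IsComposite m) (hn : Nat.IsComposite n) :
    PaperGC.HasNondegSkewStructure
      (Monoid.Coprod (Multiplicative (ZMod m)) (Multiplicative (ZMod n)) ×
        Multiplicative (ℤ × ℤ)) ∧
    ∃ K : Subgroup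
        (Monoid.Coprod (Multiplicative (ZMod m)) (Multiplicative (ZMod n)) ×
          Multiplicative (ℤ × ℤ)),
      K.FiniteIndex ∧ ¬ PaperGC.HasNondegSkewStructure K := by
  have h4 : ∀ k : ℕ, Nat.IsComposite k → 4 ≤ k := by
    rintro k ⟨h1, h2⟩
    by_contra h
    have : k = 2 ∨ k = 3 := by omega
    rcases this with rfl | rfl <;> exact h2 (by norm_num)
  have hm4 := h4 m hm
  have hn4 := h4 n hn
  have : NeZero m := ⟨by omega⟩
  have : NeZero n := ⟨by omega⟩
  have tor : ∀ (k : ℕ) (a : Multiplicative (ZMod k)), a ^ k = 1 := by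
    intro k a
    apply Multiplicative.toAdd.injective
    simp
  have ne0 : ∀ k j : ℕ, 4 ≤ k → 0 < j → j < 4 → (j : ZMod k) ≠ 0 := by
    intro k j hk hj hj4 h
    rw [ZMod.natCast_eq_zero_iff] at h
    have := Nat.le_of_dvd hj h
    omega
  refine ⟨GmnProof.part1 m n (by omega) (by omega) (tor m) (tor n),
    GmnProof.KK _ _, Subgroup.finiteIndex_ker _,
    GmnProof.part2 (Multiplicative.ofAdd ((1 : ℕ) : ZMod m))
      (fun i : Fin 3 => Multiplicative.ofAdd (((i : ℕ) + 1 : ℕ) : ZMod n)) ?_ ?_ ?_⟩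
  · intro h
    exact ne0 m 1 hm4 (by omega) (by omega) h
  · intro i h
    exact ne0 n (i + 1) hn4 (by omega) (by omega) h
  · intro i j h
    have h' : (((i : ℕ) + 1 : ℕ) : ZMod n) = (((j : ℕ) + 1 : ℕ) : ZMod n) := h
    rw [ZMod.natCast_eq_natCast_iff'] at h'
    rw [Nat.mod_eq_of_lt (by omega), Nat.mod_eq_of_lt (by omega)] at h'
    ext
    omega
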